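/- For every ε > 0 there exist a constant c_ε > 0 and a full density subset S ⊆ 𝒩 such that for every m ∈ S and every n ∈ 𝒩 with r₂(n) ≥ (log n)², the number of elements of 𝒩 lying strictly between m and n is at least c_ε · r₂(n)^{5/4 − ε} / log r₂(n). -/

import Mathlib

open Filter Topology

noncomputable section

/-- The set of natural numbers expressible as a sum of two squares. -/
def SOS : Set ℕ := {n | ∃ x y : ℤ, (n : ℤ) = x ^ 2 + y ^ 2}

/-- `r₂(n)`, the number of representations of `n` as a sum of two squares. -/
def r2 (n : ℕ) : ℕ := Nat.card {p : ℤ × ℤ // p.1 ^ 2 + p.2 ^ 2 = (n : ℤ)}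

/-- A subset `S ⊆ 𝒩` has full density in `𝒩`. -/
def FullDensityIn (S : Set ℕ) : Prop :=
  S ⊆ SOS ∧ Tendsto (fun x : ℕ =>
    (Nat.card {m : ℕ // m ∈ S ∧ m ≤ x} : ℝ) / (Nat.card {m : ℕ // m ∈ SOS ∧ m ≤ x} : ℝ))
    atTop (𝓝 1)

/-- The number of elements of `𝒩` lying strictly between `m` and `n`. -/
def betweenCount (m n : ℕ) : ℕ :=
  Nat.card {k : ℕ // k ∈ SOS ∧ min m n < k ∧ k < max m n}

open ArithmeticFunction in
/-- The nontrivial character modulo `4` as a real arithmetic function. -/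
def chiFour : ArithmeticFunction ℝ := ⟨fun n => ((ZMod.χ₄ (n : ZMod 4) : ℤ) : ℝ), by simp⟩

lemma chiFour_apply (n : ℕ) :
    chiFour n = if n % 2 = 0 then 0 else if n % 4 = 1 then 1 else -1 := by
  change ((ZMod.χ₄ (n : ZMod 4) : ℤ) : ℝ) = _
  rw [ZMod.χ₄_nat_eq_if_mod_four]
  split_ifs <;> simp

lemma chiFour_mul (m n : ℕ) : chiFour (m * n) = chiFour m * chiFour n := by
  change ((ZMod.χ₄ ((m * n : ℕ) : ZMod 4) : ℤ) : ℝ) =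
    ((ZMod.χ₄ (m : ZMod 4) : ℤ) : ℝ) * ((ZMod.χ₄ (n : ZMod 4) : ℤ) : ℝ)
  push_cast
  rw [map_mul]
  push_cast
  rfl

lemma abs_chiFour_le_one (n : ℕ) : |chiFour n| ≤ 1 := by
  rw [chiFour_apply]
  split_ifs <;> simp

lemma sum_Ico_chiFour_mem (a N : ℕ) (h : a ≤ N) :
    (∑ n ∈ Finset.Ico a N, chiFour n) =
      (if N % 4 = 2 ∨ N % 4 = 3 then 1 else 0) - (if a % 4 = 2 ∨ a % 4 = 3 then 1 else 0) := by
  induction N, h using Nat.le_induction with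
  | base => simp
  | succ N hN ih =>
    rw [Finset.sum_Ico_succ_top hN, ih, chiFour_apply]
    have : N % 4 < 4 := Nat.mod_lt _ (by norm_num)
    have h2 : N % 2 = N % 4 % 2 := by omega
    have h3 : (N + 1) % 4 = (N % 4 + 1) % 4 := by omega
    rw [h2, h3]
    interval_cases N % 4 <;> norm_num <;> ring

lemma abs_sum_Ico_chiFour_mul_le {f : ℕ → ℝ} {a : ℕ} (hf : ∀ n, a ≤ n → f (n + 1) ≤ f n)
    (h0 : ∀ n, a ≤ n → 0 ≤ f n) (N : ℕ) (h : a ≤ N) :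
    |∑ n ∈ Finset.Ico a N, chiFour n * f n| ≤ f a := by
  have hs : ∀ N, a ≤ N → |∑ n ∈ Finset.Ico a N, chiFour n| ≤ 1 := by
    intro N hN
    rw [sum_Ico_chiFour_mem a N hN]
    split_ifs <;> simp
  have key : |(∑ n ∈ Finset.Ico a N, chiFour n * f n) - (∑ n ∈ Finset.Ico a N, chiFour n) * f N|
      ≤ f a - f N := by
    induction N, h using Nat.le_induction with
    | base => simp
    | succ N hN ih =>
      have e : (∑ n ∈ Finset.Ico a (N + 1), chiFour n * f n)
          - (∑ n ∈ Finset.Ico a (N + 1), chiFour n) * f (N + 1)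
          = ((∑ n ∈ Finset.Ico a N, chiFour n * f n) - (∑ n ∈ Finset.Ico a N, chiFour n) * f N)
            + (∑ n ∈ Finset.Ico a (N + 1), chiFour n) * (f N - f (N + 1)) := by
        rw [Finset.sum_Ico_succ_top hN, Finset.sum_Ico_succ_top hN]
        ring
      rw [e]
      have h1 := hs (N + 1) (by omega)
      have h2 := hf N hN
      calc _ ≤ _ := abs_add_le _ _
        _ ≤ (f a - f N) + 1 * (f N - f (N + 1)) := by
          rw [abs_mul, abs_of_nonneg (sub_nonneg.2 h2)]
          gcongr
        _ = _ := by ring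
  have h1 := hs N h
  have h2 := h0 N h
  have h3 : |(∑ n ∈ Finset.Ico a N, chiFour n) * f N| ≤ f N := by
    rw [abs_mul, abs_of_nonneg h2]
    nlinarith
  rw [abs_le] at *
  constructor <;> linarith [key.1, key.2, h3.1, h3.2]

lemma Ioc_zero_eq_Ico (N : ℕ) : Finset.Ioc 0 N = Finset.Ico 1 (N + 1) := by
  ext; simp; omega

lemma abs_sum_chiFour_div_sub_le {k N : ℕ} (h : k ≤ N) :
    |(∑ n ∈ Finset.Ioc 0 N, chiFour n / n) - ∑ n ∈ Finset.Ioc 0 k, chiFour n / n|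
      ≤ 1 / ((k : ℝ) + 1) := by
  rw [Ioc_zero_eq_Ico, Ioc_zero_eq_Ico,
    ← Finset.sum_Ico_consecutive _ (show 1 ≤ k + 1 by omega) (show k + 1 ≤ N + 1 by omega),
    add_sub_cancel_left]
  have := abs_sum_Ico_chiFour_mul_le (f := fun n : ℕ => 1 / (n : ℝ)) (a := k + 1)
    (fun n hn => by
      have : (0 : ℝ) < n := by exact_mod_cast (by omega : 0 < n)
      push_cast
      gcongr
      linarith) (fun n hn => by positivity) (N + 1) (by omega)
  simpa [div_eq_mul_inv] using this

lemma two_thirds_le_sum_chiFour_div {N : ℕ} (h : 1 ≤ N) :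
    2 / 3 ≤ ∑ n ∈ Finset.Ioc 0 N, chiFour n / n := by
  have h2 : ∑ n ∈ Finset.Ioc 0 2, chiFour n / n = 1 := by
    simp [Ioc_zero_eq_Ico, Finset.sum_Ico_succ_top, chiFour_apply]
  have h1 : ∑ n ∈ Finset.Ioc 0 1, chiFour n / n = 1 := by
    simp [chiFour_apply]
  rcases h.eq_or_lt with rfl | h
  · rw [h1]; norm_num
  · have := abs_sum_chiFour_div_sub_le (show 2 ≤ N from h)
    rw [h2, abs_le] at this
    norm_num at this
    linarith [this.1]

lemma abs_sum_chiFour_mul_log_div_le (N : ℕ) :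
    |∑ n ∈ Finset.Ioc 0 N, chiFour n * (Real.log n / n)| ≤ 1 := by
  rcases le_or_gt 2 N with h | h
  · rw [Ioc_zero_eq_Ico,
      ← Finset.sum_Ico_consecutive _ (show 1 ≤ 3 by omega) (show 3 ≤ N + 1 by omega)]
    have h0 : ∑ n ∈ Finset.Ico 1 3, chiFour n * (Real.log n / n) = 0 := by
      simp [Finset.sum_Ico_succ_top, chiFour_apply]
    rw [h0, zero_add]
    have he : Real.exp 1 ≤ 3 := by linarith [Real.exp_one_lt_d9]
    have := abs_sum_Ico_chiFour_mul_le (f := fun n : ℕ => Real.log n / n) (a := 3)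
      (fun n hn => by
        have : (3 : ℝ) ≤ n := by exact_mod_cast hn
        apply Real.log_div_self_antitoneOn
        · exact he.trans this
        · simp only [Set.mem_Ici]; push_cast; linarith
        · push_cast; linarith)
      (fun n hn => by positivity) (N + 1) (by omega)
    refine this.trans ?_
    have := Real.log_le_sub_one_of_pos (show (0 : ℝ) < 3 by norm_num)
    push_cast
    rw [div_le_one (by norm_num)]
    linarith
  · interval_cases N <;> simp

open ArithmeticFunction in
lemma sum_vonMangoldt_Ioc_le : ∃ C : ℝ, 0 < C ∧ ∀ N : ℕ, ∑ n ∈ Finset.Ioc 0 N, Λ n ≤ C * N := by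
  refine ⟨Real.log 4 + 4, by positivity, fun N => ?_⟩
  have := Chebyshev.psi_le_const_mul_self (x := N) (by positivity)
  simpa [Chebyshev.psi] using this

open ArithmeticFunction in
lemma sum_log_eq_sum_vonMangoldt (N : ℕ) :
    ∑ n ∈ Finset.Ioc 0 N, Real.log n = ∑ n ∈ Finset.Ioc 0 N, Λ n * ((N / n : ℕ) : ℝ) := by
  rw [← sum_Ioc_mul_zeta_eq_sum (R := ℝ) Λ N, vonMangoldt_mul_zeta]
  rfl

lemma sum_log_bounds {N : ℕ} (hN : 1 ≤ N) :
    N * Real.log N - N ≤ ∑ n ∈ Finset.Ioc 0 N, Real.log n ∧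
      ∑ n ∈ Finset.Ioc 0 N, Real.log n ≤ N * Real.log N := by
  constructor
  · induction N, hN using Nat.le_induction with
    | base => simp
    | succ N hN ih =>
      rw [Ioc_zero_eq_Ico] at *
      rw [Finset.sum_Ico_succ_top (by omega)]
      have hN0 : (0 : ℝ) < N := by exact_mod_cast hN
      have h := Real.log_le_sub_one_of_pos (show (0 : ℝ) < (N + 1 : ℝ) / N by positivity)
      rw [Real.log_div (by positivity) (by positivity)] at h
      have h3 : N * (Real.log (N + 1) - Real.log N) ≤ N * ((N + 1 : ℝ) / N - 1) := by gcongr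
      have h4 : N * ((N + 1 : ℝ) / N - 1) = 1 := by field_simp; ring
      push_cast at *
      nlinarith
  · calc _ ≤ ∑ n ∈ Finset.Ioc 0 N, Real.log N := by
          apply Finset.sum_le_sum
          intro n hn
          rw [Finset.mem_Ioc] at hn
          have : (0 : ℝ) < n := by exact_mod_cast hn.1
          have : (n : ℝ) ≤ N := by exact_mod_cast hn.2
          gcongr
      _ = _ := by simp

open ArithmeticFunction in
lemma abs_sum_vonMangoldt_div_sub_log_le :
    ∃ C : ℝ, 0 < C ∧ ∀ N : ℕ, 1 ≤ N → |(∑ n ∈ Finset.Ioc 0 N, Λ n / n) - Real.log N| ≤ C := by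
  obtain ⟨C, hC, hψ⟩ := sum_vonMangoldt_Ioc_le
  refine ⟨C + 1, by linarith, fun N hN => ?_⟩
  have hN0 : (0 : ℝ) < N := by exact_mod_cast hN
  obtain ⟨h1, h2⟩ := sum_log_bounds hN
  rw [sum_log_eq_sum_vonMangoldt] at h1 h2
  have h3 : ∑ n ∈ Finset.Ioc 0 N, Λ n * ((N / n : ℕ) : ℝ) ≤
      N * ∑ n ∈ Finset.Ioc 0 N, Λ n / n := by
    rw [Finset.mul_sum]
    apply Finset.sum_le_sum
    intro n hn
    calc _ ≤ Λ n * ((N : ℝ) / n) :=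
          mul_le_mul_of_nonneg_left Nat.cast_div_le vonMangoldt_nonneg
      _ = _ := by ring
  have h4 : N * (∑ n ∈ Finset.Ioc 0 N, Λ n / n) - ∑ n ∈ Finset.Ioc 0 N, Λ n ≤
      ∑ n ∈ Finset.Ioc 0 N, Λ n * ((N / n : ℕ) : ℝ) := by
    rw [Finset.mul_sum, ← Finset.sum_sub_distrib]
    apply Finset.sum_le_sum
    intro n hn
    rw [Finset.mem_Ioc] at hn
    have h : (N : ℝ) / n - 1 ≤ ((N / n : ℕ) : ℝ) := by
      rw [← Nat.floor_div_eq_div (K := ℝ)]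
      exact (Nat.sub_one_lt_floor _).le
    calc _ = Λ n * ((N : ℝ) / n - 1) := by ring
      _ ≤ _ := mul_le_mul_of_nonneg_left h vonMangoldt_nonneg
  have h5 := hψ N
  rw [abs_le]
  constructor
  · nlinarith
  · by_contra! hc
    nlinarith

open ArithmeticFunction in
lemma abs_sum_chiFour_mul_vonMangoldt_div_le :
    ∃ C : ℝ, 0 < C ∧ ∀ N : ℕ, 1 ≤ N → |∑ n ∈ Finset.Ioc 0 N, chiFour n * Λ n / n| ≤ C := by
  obtain ⟨C, hC, hψ⟩ := sum_vonMangoldt_Ioc_le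
  refine ⟨3 / 2 * (C + 1), by linarith, fun N hN => ?_⟩
  have hN0 : (0 : ℝ) < N := by exact_mod_cast hN
  let f : ArithmeticFunction ℝ := ⟨fun n => chiFour n * Λ n / n, by simp⟩
  let g : ArithmeticFunction ℝ := ⟨fun n => chiFour n / n, by simp⟩
  have hfg : ∀ n, (f * g) n = chiFour n * (Real.log n / n) := by
    intro n
    rw [ArithmeticFunction.mul_apply, ← vonMangoldt_sum, Finset.sum_div, Finset.mul_sum,
      ← Nat.sum_divisorsAntidiagonal (f := fun i _ => chiFour n * (Λ i / (n : ℝ)))]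
    apply Finset.sum_congr rfl
    rintro ⟨a, b⟩ hab
    rw [Nat.mem_divisorsAntidiagonal] at hab
    obtain ⟨rfl, h0⟩ := hab
    change chiFour a * Λ a / a * (chiFour b / b) = _
    rw [chiFour_mul]
    push_cast
    simp only [div_eq_mul_inv, mul_inv]
    ring
  have h1 := sum_Ioc_mul_eq_sum_sum f g N
  rw [Finset.sum_congr rfl (fun n _ => hfg n)] at h1
  have h2 := abs_sum_chiFour_mul_log_div_le N
  rw [h1] at h2
  set G : ℕ → ℝ := fun N => ∑ n ∈ Finset.Ioc 0 N, chiFour n / n with hG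
  change |∑ n ∈ Finset.Ioc 0 N, f n * G (N / n)| ≤ 1 at h2
  change |∑ n ∈ Finset.Ioc 0 N, f n| ≤ _
  have h3 : |(∑ n ∈ Finset.Ioc 0 N, f n) * G N - ∑ n ∈ Finset.Ioc 0 N, f n * G (N / n)| ≤ C := by
    rw [Finset.sum_mul, ← Finset.sum_sub_distrib]
    calc _ ≤ ∑ n ∈ Finset.Ioc 0 N, |f n * G N - f n * G (N / n)| := Finset.abs_sum_le_sum_abs _ _
      _ ≤ ∑ n ∈ Finset.Ioc 0 N, Λ n / N := by
        apply Finset.sum_le_sum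
        intro n hn
        rw [Finset.mem_Ioc] at hn
        have hn0 : (0 : ℝ) < n := by exact_mod_cast hn.1
        rw [← mul_sub, abs_mul]
        have e1 : |f n| ≤ Λ n / n := by
          change |chiFour n * Λ n / n| ≤ _
          rw [abs_div, abs_mul, abs_of_pos hn0, abs_of_nonneg (vonMangoldt_nonneg (n := n))]
          gcongr
          exact mul_le_of_le_one_left vonMangoldt_nonneg (abs_chiFour_le_one n)
        have e2 : |G N - G (N / n)| ≤ n / N := by
          refine (abs_sum_chiFour_div_sub_le (Nat.div_le_self N n)).trans ?_
          rw [div_le_div_iff₀ (by positivity) hN0, one_mul]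
          have := Nat.lt_mul_div_succ N hn.1
          exact_mod_cast this.le
        calc _ ≤ Λ n / n * (n / N) :=
              mul_le_mul e1 e2 (abs_nonneg _) (div_nonneg vonMangoldt_nonneg hn0.le)
          _ = _ := by field_simp
      _ ≤ C := by
        rw [← Finset.sum_div, div_le_iff₀ hN0]
        exact hψ N
  have h4 : |(∑ n ∈ Finset.Ioc 0 N, f n) * G N| ≤ C + 1 := by
    rw [abs_le] at *
    constructor <;> linarith [h2.1, h2.2, h3.1, h3.2]
  have h5 : 2 / 3 ≤ G N := two_thirds_le_sum_chiFour_div hN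
  rw [abs_mul, abs_of_pos (show 0 < G N by linarith)] at h4
  nlinarith [abs_nonneg (∑ n ∈ Finset.Ioc 0 N, f n)]

open ArithmeticFunction in
/-- The von Mangoldt function restricted to the `n` which are not `3` modulo `4`. -/
def vonMangoldtNotThree (n : ℕ) : ℝ := if n % 4 = 3 then 0 else Λ n

lemma vonMangoldtNotThree_nonneg (n : ℕ) : 0 ≤ vonMangoldtNotThree n := by
  unfold vonMangoldtNotThree
  split_ifs
  · rfl
  · exact ArithmeticFunction.vonMangoldt_nonneg

open ArithmeticFunction in
lemma vonMangoldtNotThree_le (n : ℕ) : vonMangoldtNotThree n ≤ Λ n := by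
  unfold vonMangoldtNotThree
  split_ifs
  · exact vonMangoldt_nonneg
  · rfl

open ArithmeticFunction in
lemma half_one_add_chiFour_mul_vonMangoldt_le (n : ℕ) :
    (Λ n + chiFour n * Λ n) / 2 ≤ vonMangoldtNotThree n := by
  have h := vonMangoldt_nonneg (n := n)
  unfold vonMangoldtNotThree
  rw [chiFour_apply]
  split_ifs <;> first | omega | linarith

open ArithmeticFunction in
/-- A Chebyshev-type lower bound for prime powers that are not `3` modulo `4`. -/
lemma exists_le_sum_vonMangoldtNotThree :
    ∃ K : ℕ, 0 < K ∧ ∀ N : ℕ, K ≤ N →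
      (N : ℝ) / K ≤ ∑ n ∈ Finset.Ioc 0 N, vonMangoldtNotThree n := by
  obtain ⟨C₁, hC₁, h₁⟩ := abs_sum_vonMangoldt_div_sub_log_le
  obtain ⟨C₂, hC₂, h₂⟩ := abs_sum_chiFour_mul_vonMangoldt_div_le
  obtain ⟨K, hK⟩ := exists_nat_ge (Real.exp (2 * C₁ + 2 * C₂ + 2))
  have hK0 : (0 : ℝ) < K := (Real.exp_pos _).trans_le hK
  refine ⟨K, by exact_mod_cast hK0, fun N hN => ?_⟩
  have hKpos : 0 < K := by exact_mod_cast hK0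
  have hN0 : (0 : ℝ) < N := by exact_mod_cast hKpos.trans_le hN
  have hlogK : 2 * C₁ + 2 * C₂ + 2 ≤ Real.log K := (Real.le_log_iff_exp_le hK0).2 hK
  have hNK : 1 ≤ N / K := (Nat.one_le_div_iff hKpos).2 hN
  have hsub : N / K ≤ N := Nat.div_le_self _ _
  have hlog : Real.log ((N / K : ℕ) : ℝ) ≤ Real.log N - Real.log K := by
    rw [← Real.log_div hN0.ne' hK0.ne']
    exact Real.log_le_log (by exact_mod_cast hNK) Nat.cast_div_le
  have hsplit : ∀ f : ℕ → ℝ, ∑ n ∈ Finset.Ioc 0 N, f n =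
      ∑ n ∈ Finset.Ioc 0 (N / K), f n + ∑ n ∈ Finset.Ioc (N / K) N, f n := fun f =>
    (Finset.sum_Ioc_consecutive f (Nat.zero_le _) hsub).symm
  have a1 := h₁ N (hNK.trans hsub)
  have a2 := h₂ N (hNK.trans hsub)
  have b1 := h₁ _ hNK
  have b2 := h₂ _ hNK
  rw [hsplit, abs_le] at a1 a2
  rw [abs_le] at b1 b2
  have key : 1 ≤ ∑ n ∈ Finset.Ioc (N / K) N, (Λ n + chiFour n * Λ n) / 2 / n := by
    have e : ∑ n ∈ Finset.Ioc (N / K) N, (Λ n + chiFour n * Λ n) / 2 / n =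
        (∑ n ∈ Finset.Ioc (N / K) N, Λ n / n
          + ∑ n ∈ Finset.Ioc (N / K) N, chiFour n * Λ n / n) / 2 := by
      rw [← Finset.sum_add_distrib, Finset.sum_div]
      exact Finset.sum_congr rfl fun n _ => by ring
    rw [e]
    linarith [a1.1, a2.1, b1.2, b2.2]
  calc (N : ℝ) / K = N / K * 1 := by ring
    _ ≤ N / K * ∑ n ∈ Finset.Ioc (N / K) N, (Λ n + chiFour n * Λ n) / 2 / n := by gcongr
    _ ≤ ∑ n ∈ Finset.Ioc (N / K) N, vonMangoldtNotThree n := by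
      rw [Finset.mul_sum]
      apply Finset.sum_le_sum
      intro n hn
      rw [Finset.mem_Ioc] at hn
      have hn0 : (0 : ℝ) < n := by exact_mod_cast (Nat.zero_le _).trans_lt hn.1
      have hn1 : (N : ℝ) / K ≤ n := by
        rw [div_le_iff₀ hK0]
        exact_mod_cast ((Nat.div_lt_iff_lt_mul hKpos).1 hn.1).le
      have hw := vonMangoldtNotThree_nonneg n
      calc (N : ℝ) / K * ((Λ n + chiFour n * Λ n) / 2 / n)
          ≤ N / K * (vonMangoldtNotThree n / n) := by
            gcongr
            exact half_one_add_chiFour_mul_vonMangoldt_le n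
        _ ≤ n * (vonMangoldtNotThree n / n) := by gcongr
        _ = _ := by field_simp
    _ ≤ _ := by
      rw [hsplit]
      exact le_add_of_nonneg_left (Finset.sum_nonneg fun n _ => vonMangoldtNotThree_nonneg n)

lemma SOS_mul {m n : ℕ} (hm : m ∈ SOS) (hn : n ∈ SOS) : m * n ∈ SOS := by
  obtain ⟨a, b, h1⟩ := hm
  obtain ⟨c, d, h2⟩ := hn
  obtain ⟨r, s, h⟩ := sq_add_sq_mul h1 h2
  exact ⟨r, s, by push_cast; exact h⟩

lemma sq_mem_SOS (a : ℕ) : a ^ 2 ∈ SOS := ⟨a, 0, by push_cast; ring⟩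

lemma one_mem_SOS : 1 ∈ SOS := sq_mem_SOS 1

lemma pow_mem_SOS {m : ℕ} (h : m ∈ SOS) (k : ℕ) : m ^ k ∈ SOS := by
  induction k with
  | zero => exact one_mem_SOS
  | succ k ih => exact pow_succ m k ▸ SOS_mul ih h

lemma prime_mem_SOS {p : ℕ} (hp : p.Prime) (h : p % 4 ≠ 3) : p ∈ SOS := by
  have : Fact p.Prime := ⟨hp⟩
  obtain ⟨a, b, h⟩ := Nat.Prime.sq_add_sq h
  exact ⟨a, b, by rw [← h]; push_cast; ring⟩

lemma mem_SOS_of_isPrimePow {n : ℕ} (hn : IsPrimePow n) (h : n % 4 ≠ 3) : n ∈ SOS := by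
  obtain ⟨p, k, hp, -, rfl⟩ := (isPrimePow_nat_iff n).1 hn
  by_cases h3 : p % 4 = 3
  · rcases Nat.even_or_odd' k with ⟨j, rfl | rfl⟩
    · rw [pow_mul']
      exact sq_mem_SOS _
    · exfalso
      apply h
      rw [pow_succ, pow_mul, Nat.mul_mod, Nat.pow_mod, Nat.pow_mod p, h3]
      simp
  · exact pow_mem_SOS (prime_mem_SOS hp h3) k

open scoped Classical in
/-- The indicator function of the positive sums of two squares. -/
def sosIndicator : ArithmeticFunction ℝ :=
  ⟨fun n => if n ∈ SOS ∧ n ≠ 0 then 1 else 0, by simp⟩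

open scoped Classical in
lemma sosIndicator_apply (n : ℕ) :
    sosIndicator n = if n ∈ SOS ∧ n ≠ 0 then 1 else 0 := rfl

lemma sosIndicator_of_mem {n : ℕ} (h : n ∈ SOS) (h0 : n ≠ 0) : sosIndicator n = 1 :=
  if_pos ⟨h, h0⟩

lemma sosIndicator_of_notMem {n : ℕ} (h : n ∉ SOS) : sosIndicator n = 0 :=
  if_neg fun h' => h h'.1

lemma sosIndicator_nonneg (n : ℕ) : 0 ≤ sosIndicator n := by
  rw [sosIndicator_apply]
  split_ifs <;> simp

lemma sosIndicator_le_one (n : ℕ) : sosIndicator n ≤ 1 := by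
  rw [sosIndicator_apply]
  split_ifs <;> simp

lemma sosIndicator_mul_vonMangoldtNotThree_le (m n : ℕ) :
    sosIndicator m * vonMangoldtNotThree n ≤ sosIndicator (m * n) * vonMangoldtNotThree n := by
  by_cases hn : IsPrimePow n ∧ n % 4 ≠ 3
  · have h := mem_SOS_of_isPrimePow hn.1 hn.2
    gcongr
    · exact vonMangoldtNotThree_nonneg n
    · by_cases hm : m ∈ SOS ∧ m ≠ 0
      · rw [sosIndicator_of_mem hm.1 hm.2,
          sosIndicator_of_mem (SOS_mul hm.1 h) (mul_ne_zero hm.2 hn.1.ne_zero)]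
      · have : sosIndicator m = 0 := if_neg hm
        rw [this]
        exact sosIndicator_nonneg _
  · have : vonMangoldtNotThree n = 0 := by
      unfold vonMangoldtNotThree
      split_ifs with h
      · rfl
      · exact ArithmeticFunction.vonMangoldt_eq_zero_iff.2 fun h' => hn ⟨h', h⟩
    simp [this]

open ArithmeticFunction in
lemma sum_sosIndicator_mul_vonMangoldtNotThree_le (N : ℕ) :
    ∑ m ∈ Finset.Ioc 0 N, sosIndicator m * ∑ n ∈ Finset.Ioc 0 (N / m), vonMangoldtNotThree n ≤
      ∑ n ∈ Finset.Ioc 0 N, sosIndicator n * Real.log n := by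
  let w : ArithmeticFunction ℝ := ⟨vonMangoldtNotThree, by simp [vonMangoldtNotThree]⟩
  change ∑ m ∈ Finset.Ioc 0 N, sosIndicator m * ∑ n ∈ Finset.Ioc 0 (N / m), w n ≤ _
  rw [← sum_Ioc_mul_eq_sum_sum]
  apply Finset.sum_le_sum
  intro n hn
  rw [ArithmeticFunction.mul_apply, ← vonMangoldt_sum, Finset.mul_sum,
    ← Nat.sum_divisorsAntidiagonal' (f := fun _ i => sosIndicator n * Λ i)]
  apply Finset.sum_le_sum
  rintro ⟨a, b⟩ hab
  rw [Nat.mem_divisorsAntidiagonal] at hab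
  rw [← hab.1]
  refine (sosIndicator_mul_vonMangoldtNotThree_le a b).trans ?_
  exact mul_le_mul_of_nonneg_left (vonMangoldtNotThree_le b) (sosIndicator_nonneg _)

lemma mem_SOS_iff (n : ℕ) :
    n ∈ SOS ↔ ∀ q ∈ n.primeFactors, q % 4 = 3 → Even (padicValNat q n) := by
  rw [← Nat.eq_sq_add_sq_iff]
  constructor
  · rintro ⟨x, y, h⟩
    refine ⟨x.natAbs, y.natAbs, ?_⟩
    zify
    simpa using h
  · rintro ⟨x, y, h⟩
    exact ⟨x, y, by exact_mod_cast h⟩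

lemma sosIndicator_isMultiplicative : sosIndicator.IsMultiplicative := by
  refine ArithmeticFunction.IsMultiplicative.iff_ne_zero.2
    ⟨sosIndicator_of_mem one_mem_SOS one_ne_zero, ?_⟩
  intro m n hm hn hmn
  have key : m * n ∈ SOS ↔ m ∈ SOS ∧ n ∈ SOS := by
    refine ⟨fun h => ?_, fun h => SOS_mul h.1 h.2⟩
    have : ∀ m n : ℕ, m ≠ 0 → n ≠ 0 → m.Coprime n → m * n ∈ SOS → m ∈ SOS := by
      intro m n hm hn hmn h
      rw [mem_SOS_iff] at h ⊢
      intro q hq hq3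
      have hqp := Nat.prime_of_mem_primeFactors hq
      have : Fact q.Prime := ⟨hqp⟩
      have hqn : ¬ q ∣ n := fun hd =>
        hqp.one_lt.ne' (Nat.eq_one_of_dvd_coprimes hmn (Nat.dvd_of_mem_primeFactors hq) hd)
      have := h q (Nat.primeFactors_mono (Dvd.intro _ rfl) (mul_ne_zero hm hn) hq) hq3
      rwa [padicValNat.mul hm hn, padicValNat.eq_zero_of_not_dvd hqn, add_zero] at this
    exact ⟨this m n hm hn hmn h, this n m hn hm hmn.symm (mul_comm m n ▸ h)⟩
  by_cases h1 : m ∈ SOS <;> by_cases h2 : n ∈ SOS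
  · rw [sosIndicator_of_mem h1 hm, sosIndicator_of_mem h2 hn,
      sosIndicator_of_mem (key.2 ⟨h1, h2⟩) (mul_ne_zero hm hn), one_mul]
  all_goals
    rw [sosIndicator_of_notMem (fun h => by tauto)]
    first | rw [sosIndicator_of_notMem h1, zero_mul] | rw [sosIndicator_of_notMem h2, mul_zero]

lemma chiFour_isMultiplicative : chiFour.IsMultiplicative :=
  ⟨by simp [chiFour_apply], fun {m n} _ => chiFour_mul m n⟩

lemma chiFour_pow_of_three {p : ℕ} (h3 : p % 4 = 3) (i : ℕ) : chiFour (p ^ i) = (-1) ^ i := by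
  induction i with
  | zero => simp [chiFour_apply]
  | succ i ih =>
    rw [pow_succ, chiFour_mul, ih, pow_succ, chiFour_apply p, if_neg (by omega),
      if_neg (by omega)]

lemma sum_chiFour_pow_le (p k : ℕ) (hp : p.Prime) :
    ∑ i ∈ Finset.range (k + 1), chiFour (p ^ i) ≤
      ∑ i ∈ Finset.range (k + 1), sosIndicator (p ^ i) * sosIndicator (p ^ (k - i)) := by
  by_cases h3 : p % 4 = 3
  · have hsum : ∑ i ∈ Finset.range (k + 1), chiFour (p ^ i) = if Even k then 1 else 0 := by
      rw [Finset.sum_congr rfl fun i _ => chiFour_pow_of_three h3 i, neg_one_geom_sum]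
      split_ifs <;> simp_all [Nat.even_add_one]
    rw [hsum]
    split_ifs with hk
    · have hmem : p ^ k ∈ SOS := by
        obtain ⟨j, rfl⟩ := hk
        rw [← two_mul, pow_mul']
        exact sq_mem_SOS _
      have := Finset.single_le_sum (s := Finset.range (k + 1))
        (f := fun i => sosIndicator (p ^ i) * sosIndicator (p ^ (k - i)))
        (fun i _ => mul_nonneg (sosIndicator_nonneg _) (sosIndicator_nonneg _))
        (Finset.mem_range.2 (Nat.succ_pos k))
      simpa [sosIndicator_of_mem one_mem_SOS, sosIndicator_of_mem hmem, hp.ne_zero] using this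
    · exact Finset.sum_nonneg fun i _ =>
        mul_nonneg (sosIndicator_nonneg _) (sosIndicator_nonneg _)
  · apply Finset.sum_le_sum
    intro i _
    rw [sosIndicator_of_mem (pow_mem_SOS (prime_mem_SOS hp h3) _) (pow_ne_zero _ hp.ne_zero),
      sosIndicator_of_mem (pow_mem_SOS (prime_mem_SOS hp h3) _) (pow_ne_zero _ hp.ne_zero)]
    linarith [(abs_le.1 (abs_chiFour_le_one (p ^ i))).2]

lemma neg_one_pow_sum_nonneg (k : ℕ) : (0 : ℝ) ≤ ∑ i ∈ Finset.range k, (-1 : ℝ) ^ i := by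
  rw [neg_one_geom_sum]
  split_ifs <;> simp

open ArithmeticFunction in
lemma chiFour_mul_zeta_le (n : ℕ) :
    0 ≤ (chiFour * ((zeta : ArithmeticFunction ℕ) : ArithmeticFunction ℝ)) n ∧
      (chiFour * ((zeta : ArithmeticFunction ℕ) : ArithmeticFunction ℝ)) n ≤
        (sosIndicator * sosIndicator) n := by
  have hm1 : (chiFour * ((zeta : ArithmeticFunction ℕ) : ArithmeticFunction ℝ)).IsMultiplicative :=
    chiFour_isMultiplicative.mul isMultiplicative_zeta.natCast
  have hm2 : (sosIndicator * sosIndicator).IsMultiplicative :=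
    sosIndicator_isMultiplicative.mul sosIndicator_isMultiplicative
  induction n using Nat.recOnPosPrimePosCoprime with
  | prime_pow p k hp hk =>
    have e1 : (chiFour * ((zeta : ArithmeticFunction ℕ) : ArithmeticFunction ℝ)) (p ^ k) =
        ∑ i ∈ Finset.range (k + 1), chiFour (p ^ i) := by
      rw [coe_mul_zeta_apply, Nat.sum_divisors_prime_pow hp]
    have e2 : (sosIndicator * sosIndicator) (p ^ k) =
        ∑ i ∈ Finset.range (k + 1), sosIndicator (p ^ i) * sosIndicator (p ^ (k - i)) := by
      rw [ArithmeticFunction.mul_apply, Nat.sum_divisorsAntidiagonal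
        (f := fun a b => sosIndicator a * sosIndicator b), Nat.sum_divisors_prime_pow hp]
      apply Finset.sum_congr rfl
      intro i hi
      rw [Nat.pow_div (by simpa [Nat.lt_succ_iff] using hi) hp.pos]
    refine ⟨?_, ?_⟩
    · rw [e1]
      by_cases h3 : p % 4 = 3
      · rw [Finset.sum_congr rfl fun i _ => chiFour_pow_of_three h3 i]
        exact neg_one_pow_sum_nonneg _
      · have hp0 : 0 ≤ chiFour p := by
          rw [chiFour_apply]
          split_ifs
          · rfl
          · exact zero_le_one
          · omega
        apply Finset.sum_nonneg
        intro i _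
        induction i with
        | zero => simp [chiFour_apply]
        | succ i ih =>
          rw [pow_succ, chiFour_mul]
          exact mul_nonneg (ih (by simp_all; omega)) hp0
    · rw [e1, e2]
      exact sum_chiFour_pow_le p k hp
  | zero => simp
  | one => simp [hm1.1, hm2.1]
  | coprime a b _ _ hab iha ihb =>
    rw [hm1.2 hab, hm2.2 hab]
    exact ⟨mul_nonneg iha.1 ihb.1, mul_le_mul iha.2 ihb.2 ihb.1 (iha.1.trans iha.2)⟩

/-- The arithmetic function `n ↦ f n / n`. -/
def divId (f : ArithmeticFunction ℝ) : ArithmeticFunction ℝ := ⟨fun n => f n / n, by simp⟩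

lemma divId_apply (f : ArithmeticFunction ℝ) (n : ℕ) : divId f n = f n / n := rfl

lemma divId_mul (f g : ArithmeticFunction ℝ) : divId (f * g) = divId f * divId g := by
  ext n
  rw [divId_apply, ArithmeticFunction.mul_apply, ArithmeticFunction.mul_apply, Finset.sum_div]
  apply Finset.sum_congr rfl
  rintro ⟨a, b⟩ hab
  rw [Nat.mem_divisorsAntidiagonal] at hab
  rw [← hab.1, divId_apply, divId_apply]
  push_cast
  rw [div_mul_div_comm]

lemma divId_sosIndicator_nonneg (n : ℕ) : 0 ≤ divId sosIndicator n :=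
  div_nonneg (sosIndicator_nonneg n) (Nat.cast_nonneg n)

open ArithmeticFunction in
lemma log_le_sq_sum_divId_sosIndicator (N : ℕ) :
    2 / 3 * Real.log (N + 1) ≤ (∑ n ∈ Finset.Ioc 0 N, divId sosIndicator n) ^ 2 := by
  set Z : ArithmeticFunction ℝ := ((zeta : ArithmeticFunction ℕ) : ArithmeticFunction ℝ) with hZ
  calc 2 / 3 * Real.log (N + 1)
      ≤ ∑ n ∈ Finset.Ioc 0 N, (1 / (n : ℝ)) * (2 / 3) := by
        rw [← Finset.sum_mul, mul_comm]
        gcongr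
        have h := log_add_one_le_harmonic N
        rw [harmonic_eq_sum_Icc] at h
        push_cast at h
        simpa [← Finset.Icc_add_one_left_eq_Ioc] using h
    _ ≤ ∑ n ∈ Finset.Ioc 0 N, divId Z n * ∑ m ∈ Finset.Ioc 0 (N / n), divId chiFour m := by
        apply Finset.sum_le_sum
        intro n hn
        rw [Finset.mem_Ioc] at hn
        have h1 : divId Z n = 1 / n := by
          simp [divId_apply, hZ, natCoe_apply, zeta_apply, hn.1.ne']
        rw [h1]
        gcongr
        exact two_thirds_le_sum_chiFour_div ((Nat.one_le_div_iff hn.1).2 hn.2)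
    _ = ∑ n ∈ Finset.Ioc 0 N, divId (chiFour * Z) n := by
        rw [mul_comm, divId_mul, sum_Ioc_mul_eq_sum_sum]
    _ ≤ ∑ n ∈ Finset.Ioc 0 N, divId (sosIndicator * sosIndicator) n := by
        apply Finset.sum_le_sum
        intro n hn
        rw [divId_apply, divId_apply]
        gcongr
        exact (chiFour_mul_zeta_le n).2
    _ = ∑ n ∈ Finset.Ioc 0 N,
          divId sosIndicator n * ∑ m ∈ Finset.Ioc 0 (N / n), divId sosIndicator m := by
        rw [divId_mul, sum_Ioc_mul_eq_sum_sum]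
    _ ≤ ∑ n ∈ Finset.Ioc 0 N,
          divId sosIndicator n * ∑ m ∈ Finset.Ioc 0 N, divId sosIndicator m := by
        apply Finset.sum_le_sum
        intro n hn
        refine mul_le_mul_of_nonneg_left ?_ (divId_sosIndicator_nonneg n)
        exact Finset.sum_le_sum_of_subset_of_nonneg
          (Finset.Ioc_subset_Ioc_right (Nat.div_le_self _ _))
          fun m _ _ => divId_sosIndicator_nonneg m
    _ = _ := by rw [← Finset.sum_mul, sq]

/-- The lower bound in Landau's theorem on the number of sums of two squares. -/
lemma exists_le_sum_sosIndicator :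
    ∃ c : ℝ, 0 < c ∧ ∃ N₀ : ℕ, 2 ≤ N₀ ∧ ∀ N : ℕ, N₀ ≤ N →
      c * N ≤ (∑ n ∈ Finset.Ioc 0 N, sosIndicator n) * √(Real.log N) := by
  obtain ⟨K, hK, hw⟩ := exists_le_sum_vonMangoldtNotThree
  have hK0 : (0 : ℝ) < K := by exact_mod_cast hK
  refine ⟨1 / (4 * K), by positivity, max 2 (K ^ 2), le_max_left _ _, fun N hN => ?_⟩
  have hN2 : 2 ≤ N := (le_max_left _ _).trans hN
  have hNK : K ^ 2 ≤ N := (le_max_right _ _).trans hN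
  have hKN : K ≤ N := (Nat.le_self_pow two_ne_zero K).trans hNK
  have hN0 : (0 : ℝ) < N := by exact_mod_cast (by omega : 0 < N)
  have hlog : 0 < Real.log N := Real.log_pos (by exact_mod_cast (by omega : 1 < N))
  set B := ∑ n ∈ Finset.Ioc 0 N, sosIndicator n with hB
  set β := ∑ n ∈ Finset.Ioc 0 (N / K), divId sosIndicator n with hβ
  have hβ0 : 0 ≤ β := Finset.sum_nonneg fun n _ => divId_sosIndicator_nonneg n
  have h1 : N / (2 * K) * β ≤ B * Real.log N := by
    calc N / (2 * K) * β
        ≤ ∑ m ∈ Finset.Ioc 0 (N / K),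
            sosIndicator m * ∑ n ∈ Finset.Ioc 0 (N / m), vonMangoldtNotThree n := by
          rw [hβ, Finset.mul_sum]
          apply Finset.sum_le_sum
          intro m hm
          rw [Finset.mem_Ioc] at hm
          have hm0 : (0 : ℝ) < m := by exact_mod_cast hm.1
          have hmK : K ≤ N / m := by
            rw [Nat.le_div_iff_mul_le hm.1]
            rw [Nat.le_div_iff_mul_le hK] at hm
            linarith [hm.2]
          have h2 : (N : ℝ) / m ≤ 2 * (N / m : ℕ) := by
            rw [div_le_iff₀ hm0]
            have e1 := Nat.lt_mul_div_succ N hm.1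
            have e2 : m * (N / m + 1) ≤ m * (2 * (N / m)) := Nat.mul_le_mul_left _ (by omega)
            have e3 : N ≤ 2 * (N / m) * m := by linarith
            exact_mod_cast e3
          calc N / (2 * K) * divId sosIndicator m
              = sosIndicator m * (N / m / 2 / K) := by rw [divId_apply]; field_simp
            _ ≤ sosIndicator m * ((N / m : ℕ) / K) := by
              refine mul_le_mul_of_nonneg_left ?_ (sosIndicator_nonneg m)
              gcongr
              linarith
            _ ≤ _ := mul_le_mul_of_nonneg_left (hw _ hmK) (sosIndicator_nonneg m)
      _ ≤ ∑ m ∈ Finset.Ioc 0 N,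
            sosIndicator m * ∑ n ∈ Finset.Ioc 0 (N / m), vonMangoldtNotThree n :=
          Finset.sum_le_sum_of_subset_of_nonneg
            (Finset.Ioc_subset_Ioc_right (Nat.div_le_self _ _))
            fun m _ _ => mul_nonneg (sosIndicator_nonneg m)
              (Finset.sum_nonneg fun n _ => vonMangoldtNotThree_nonneg n)
      _ ≤ ∑ n ∈ Finset.Ioc 0 N, sosIndicator n * Real.log n :=
          sum_sosIndicator_mul_vonMangoldtNotThree_le N
      _ ≤ _ := by
          rw [hB, Finset.sum_mul]
          apply Finset.sum_le_sum
          intro n hn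
          rw [Finset.mem_Ioc] at hn
          have : (0 : ℝ) < n := by exact_mod_cast hn.1
          have : (n : ℝ) ≤ N := by exact_mod_cast hn.2
          exact mul_le_mul_of_nonneg_left (Real.log_le_log ‹_› ‹_›) (sosIndicator_nonneg n)
  have h2 : Real.log N / 4 ≤ β ^ 2 := by
    have h3 := log_le_sq_sum_divId_sosIndicator (N / K)
    have h4 : Real.log N / 2 ≤ Real.log ((N / K : ℕ) + 1) := by
      have e1 : (N : ℝ) / K ≤ (N / K : ℕ) + 1 := by
        rw [div_le_iff₀ hK0]
        have := (Nat.lt_mul_div_succ N hK).le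
        rw [mul_comm] at this
        exact_mod_cast this
      have e2 := Real.log_le_log (by positivity) e1
      have e3 : Real.log (K ^ 2) ≤ Real.log N :=
        Real.log_le_log (by positivity) (by exact_mod_cast hNK)
      rw [Real.log_div hN0.ne' hK0.ne'] at e2
      rw [Real.log_pow] at e3
      push_cast at e3
      linarith
    linarith
  have h3 : √(Real.log N) / 2 ≤ β := by
    refine le_of_sq_le_sq ?_ hβ0
    rw [div_pow, Real.sq_sqrt hlog.le]
    linarith
  have hs : 0 < √(Real.log N) := Real.sqrt_pos.2 hlog
  have h4 : N / (2 * K) * (√(Real.log N) / 2) ≤ B * √(Real.log N) * √(Real.log N) := by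
    rw [mul_assoc, Real.mul_self_sqrt hlog.le]
    refine le_trans ?_ h1
    gcongr
  refine le_of_mul_le_mul_right ?_ hs
  refine le_trans (le_of_eq ?_) h4
  field_simp
  ring

/-- The representations of `n` as a sum of two squares, as a finset. -/
def repFinset (n : ℕ) : Finset (ℤ × ℤ) :=
  (Finset.Icc (-(n.sqrt : ℤ)) n.sqrt ×ˢ Finset.Icc (-(n.sqrt : ℤ)) n.sqrt).filter
    fun p => p.1 ^ 2 + p.2 ^ 2 = (n : ℤ)

lemma mem_repFinset {n : ℕ} {p : ℤ × ℤ} : p ∈ repFinset n ↔ p.1 ^ 2 + p.2 ^ 2 = (n : ℤ) := by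
  have key : ∀ x y : ℤ, x ^ 2 + y ^ 2 = n → -(n.sqrt : ℤ) ≤ x ∧ x ≤ n.sqrt := by
    intro x y h
    have h1 : x.natAbs ≤ n.sqrt := by
      rw [Nat.le_sqrt']
      zify
      rw [sq_abs]
      nlinarith [sq_nonneg y]
    omega
  simp only [repFinset, Finset.mem_filter, Finset.mem_product, Finset.mem_Icc, and_iff_right_iff_imp]
  exact fun h => ⟨key _ _ h, key _ p.1 (by rw [add_comm]; exact h)⟩

lemma r2_eq_card (n : ℕ) : r2 n = (repFinset n).card := by
  rw [r2, Nat.subtype_card]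
  exact fun p => mem_repFinset

lemma r2_le (n : ℕ) : r2 n ≤ 2 * (2 * n.sqrt + 1) := by
  have h : (repFinset n).card ≤
      (Finset.Icc (-(n.sqrt : ℤ)) n.sqrt ×ˢ (Finset.univ : Finset Bool)).card := by
    refine Finset.card_le_card_of_injOn (fun p => (p.1, decide (0 ≤ p.2))) ?_ ?_
    · intro p hp
      simp only [repFinset, Finset.coe_filter, Finset.mem_product, Set.mem_ofPred_eq] at hp
      simp only [Finset.coe_product, Set.mem_prod, Finset.mem_coe]
      exact ⟨hp.1.1, Finset.mem_univ _⟩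
    · rintro ⟨a, b⟩ hp ⟨c, d⟩ hq h
      rw [Finset.mem_coe, mem_repFinset] at hp hq
      simp only [Prod.mk.injEq, decide_eq_decide] at h hp hq ⊢
      obtain ⟨rfl, h⟩ := h
      refine ⟨rfl, ?_⟩
      have hs : b ^ 2 = d ^ 2 := by linarith
      rcases sq_eq_sq_iff_eq_or_eq_neg.1 hs with h' | h' <;> omega
  rw [r2_eq_card]
  refine h.trans (le_of_eq ?_)
  rw [Finset.card_product, Int.card_Icc, Finset.card_univ, Fintype.card_bool]
  omega

lemma one_le_r2 {n : ℕ} (h : n ∈ SOS) : 1 ≤ r2 n := by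
  obtain ⟨x, y, h⟩ := h
  rw [r2_eq_card, Nat.one_le_iff_ne_zero, Finset.card_ne_zero]
  exact ⟨(x, y), mem_repFinset.2 h.symm⟩

/-- The solutions of `u * v = w * z` with `u, v, w, z ≤ T`. -/
def mulEqFinset (T : ℕ) : Finset ((ℕ × ℕ) × (ℕ × ℕ)) :=
  ((Finset.range (T + 1) ×ˢ Finset.range (T + 1)) ×ˢ
    (Finset.range (T + 1) ×ˢ Finset.range (T + 1))).filter
      fun p => p.1.1 * p.1.2 = p.2.1 * p.2.2

lemma mem_mulEqFinset {T u v w z : ℕ} : ((u, v), (w, z)) ∈ mulEqFinset T ↔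
    ((u ≤ T ∧ v ≤ T) ∧ (w ≤ T ∧ z ≤ T)) ∧ u * v = w * z := by
  simp [mulEqFinset]

lemma sum_r2_sq_le_card (N : ℕ) :
    ∑ n ∈ Finset.Ioc 0 N, r2 n ^ 2 ≤ 16 * (mulEqFinset (2 * N.sqrt)).card := by
  have e : ∑ n ∈ Finset.Ioc 0 N, r2 n ^ 2 =
      ((Finset.Ioc 0 N).sigma fun n => repFinset n ×ˢ repFinset n).card := by
    rw [Finset.card_sigma]
    exact Finset.sum_congr rfl fun n _ => by rw [Finset.card_product, r2_eq_card, sq]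
  have e2 : 16 * (mulEqFinset (2 * N.sqrt)).card =
      (mulEqFinset (2 * N.sqrt) ×ˢ (Finset.univ : Finset (Bool × Bool × Bool × Bool))).card := by
    rw [Finset.card_product, Finset.card_univ, mul_comm]
    simp [Fintype.card_prod]
  rw [e, e2]
  refine Finset.card_le_card_of_injOn (fun s =>
    ((((s.2.1.1 - s.2.2.1).natAbs, (s.2.1.1 + s.2.2.1).natAbs),
      ((s.2.2.2 - s.2.1.2).natAbs, (s.2.2.2 + s.2.1.2).natAbs)),
      (decide (0 ≤ s.2.1.1 - s.2.2.1), decide (0 ≤ s.2.1.1 + s.2.2.1),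
        decide (0 ≤ s.2.2.2 - s.2.1.2), decide (0 ≤ s.2.2.2 + s.2.1.2)))) ?_ ?_
  · rintro ⟨n, ⟨a, b⟩, ⟨c, d⟩⟩ hs
    simp only [Finset.coe_sigma, Set.mem_sigma_iff, Finset.mem_coe, Finset.mem_product,
      Finset.mem_Ioc] at hs
    obtain ⟨⟨-, hn⟩, hp, hq⟩ := hs
    have hN : (n.sqrt : ℤ) ≤ N.sqrt := by exact_mod_cast Nat.sqrt_le_sqrt hn
    have hp' := mem_repFinset.1 hp
    have hq' := mem_repFinset.1 hq
    simp only [repFinset, Finset.mem_filter, Finset.mem_product, Finset.mem_Icc] at hp hq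
    simp only [Finset.mem_coe, Finset.mem_product, Finset.mem_univ, and_true, mem_mulEqFinset]
    refine ⟨by omega, ?_⟩
    rw [← Int.natAbs_mul, ← Int.natAbs_mul]
    congr 1
    simp only at hp' hq'
    linarith
  · rintro ⟨n, ⟨a, b⟩, ⟨c, d⟩⟩ hs ⟨n', ⟨a', b'⟩, ⟨c', d'⟩⟩ hs' h
    simp only [Finset.coe_sigma, Set.mem_sigma_iff, Finset.mem_coe, Finset.mem_product,
      Finset.mem_Ioc] at hs hs'
    simp only [Prod.mk.injEq, decide_eq_decide] at h
    have hp := mem_repFinset.1 hs.2.1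
    have hp' := mem_repFinset.1 hs'.2.1
    simp only at hp hp'
    have h1 : a = a' := by omega
    have h2 : b = b' := by omega
    have h3 : c = c' := by omega
    have h4 : d = d' := by omega
    subst h1 h2 h3 h4
    have : n = n' := by
      zify
      rw [← hp, ← hp']
    subst this
    rfl

lemma card_mulEqFinset_le (T : ℕ) : (mulEqFinset T).card ≤ 4 * (T + 1) ^ 2 +
    ∑ p ∈ Finset.Ioc 0 T ×ˢ Finset.Ioc 0 T, (T / max p.1 p.2) ^ 2 := by
  classical
  let Z : Finset ((ℕ × ℕ) × (Bool × Bool)) :=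
    (Finset.range (T + 1) ×ˢ Finset.range (T + 1)) ×ˢ Finset.univ
  let φ : (ℕ × ℕ) × (Bool × Bool) → (ℕ × ℕ) × (ℕ × ℕ) := fun s =>
    (if s.2.1 then (0, s.1.1) else (s.1.1, 0), if s.2.2 then (0, s.1.2) else (s.1.2, 0))
  let P : Finset (Σ _ : ℕ × ℕ, ℕ × ℕ) := (Finset.Ioc 0 T ×ˢ Finset.Ioc 0 T).sigma fun p =>
    Finset.Ioc 0 (T / max p.1 p.2) ×ˢ Finset.Ioc 0 (T / max p.1 p.2)
  let ψ : (Σ _ : ℕ × ℕ, ℕ × ℕ) → (ℕ × ℕ) × (ℕ × ℕ) := fun s =>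
    ((s.2.1 * s.1.1, s.1.2 * s.2.2), (s.2.1 * s.1.2, s.1.1 * s.2.2))
  have hsub : mulEqFinset T ⊆ Z.image φ ∪ P.image ψ := by
    rintro ⟨⟨u, v⟩, ⟨w, z⟩⟩ h
    rw [mem_mulEqFinset] at h
    obtain ⟨⟨⟨hu, hv⟩, ⟨hw, hz⟩⟩, h⟩ := h
    rw [Finset.mem_union]
    by_cases h0 : u * v = 0
    · left
      rw [Finset.mem_image]
      refine ⟨((if u = 0 then v else u, if w = 0 then z else w), (decide (u = 0), decide (w = 0))),
        ?_, ?_⟩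
      · simp only [Z, Finset.mem_product, Finset.mem_range, Finset.mem_univ, and_true]
        constructor <;> split_ifs <;> omega
      · have h0' : w * z = 0 := h ▸ h0
        rw [mul_eq_zero] at h0 h0'
        simp only [φ, decide_eq_true_eq]
        split_ifs <;> simp_all
    · right
      have hu0 : 0 < u := Nat.pos_of_ne_zero (by rintro rfl; simp at h0)
      have hv0 : 0 < v := Nat.pos_of_ne_zero (by rintro rfl; simp at h0)
      have hw0 : 0 < w := Nat.pos_of_ne_zero (by rintro rfl; simp [h] at h0)
      have hz0 : 0 < z := Nat.pos_of_ne_zero (by rintro rfl; simp [h] at h0)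
      obtain ⟨α, β, ⟨γ, rfl⟩, ⟨δ, rfl⟩, rfl⟩ := exists_dvd_and_dvd_of_dvd_mul (Dvd.intro v h)
      have hα : 0 < α := Nat.pos_of_mul_pos_right hu0
      have hβ : 0 < β := Nat.pos_of_mul_pos_left hu0
      have hγ : 0 < γ := Nat.pos_of_mul_pos_left hw0
      have hδ : 0 < δ := Nat.pos_of_mul_pos_left hz0
      have hv' : v = γ * δ := by
        apply Nat.eq_of_mul_eq_mul_left hu0
        rw [h]
        ring
      subst hv'
      rw [Finset.mem_image]
      refine ⟨⟨(β, γ), (α, δ)⟩, ?_, rfl⟩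
      have hm : 0 < max β γ := lt_max_of_lt_left hβ
      simp only [P, Finset.mem_sigma, Finset.mem_product, Finset.mem_Ioc]
      refine ⟨⟨⟨hβ, ?_⟩, hγ, ?_⟩, ⟨hα, ?_⟩, hδ, ?_⟩
      · nlinarith
      · nlinarith
      · rw [Nat.le_div_iff_mul_le hm]
        rcases max_choice β γ with e | e <;> rw [e] <;> assumption
      · rw [Nat.le_div_iff_mul_le hm]
        rcases max_choice β γ with e | e <;> rw [e, mul_comm] <;> assumption
  refine (Finset.card_le_card hsub).trans ((Finset.card_union_le _ _).trans ?_)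
  refine add_le_add (Finset.card_image_le.trans (le_of_eq ?_))
    (Finset.card_image_le.trans (le_of_eq ?_))
  · simp only [Z, Finset.card_product, Finset.card_range, Finset.card_univ, Fintype.card_prod,
      Fintype.card_bool]
    ring
  · simp only [P, Finset.card_sigma, Finset.card_product, Nat.card_Ioc, Nat.sub_zero, sq]

lemma sum_div_max_sq_le (T : ℕ) :
    ((∑ p ∈ Finset.Ioc 0 T ×ˢ Finset.Ioc 0 T, (T / max p.1 p.2) ^ 2 : ℕ) : ℝ) ≤
      2 * T ^ 2 * (1 + Real.log T) := by
  have hin : ∀ b ∈ Finset.Ioc 0 T,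
      ∑ g ∈ Finset.Ioc 0 T, (if g ≤ b then (T : ℝ) ^ 2 / b ^ 2 else 0) = T ^ 2 * (b : ℝ)⁻¹ := by
    intro b hb
    rw [Finset.mem_Ioc] at hb
    have hb0 : (0 : ℝ) < b := by exact_mod_cast hb.1
    rw [← Finset.sum_filter, Finset.sum_const]
    have : (Finset.Ioc 0 T).filter (· ≤ b) = Finset.Ioc 0 b := by
      ext g
      simp only [Finset.mem_filter, Finset.mem_Ioc]
      omega
    rw [this, Nat.card_Ioc, Nat.sub_zero, nsmul_eq_mul]
    field_simp
  push_cast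
  rw [Finset.sum_product]
  calc _ ≤ ∑ b ∈ Finset.Ioc 0 T, ∑ g ∈ Finset.Ioc 0 T,
        ((if g ≤ b then (T : ℝ) ^ 2 / b ^ 2 else 0) + if b ≤ g then (T : ℝ) ^ 2 / g ^ 2 else 0) := by
        apply Finset.sum_le_sum
        intro b _
        apply Finset.sum_le_sum
        intro g _
        have hd : ((T / max b g : ℕ) : ℝ) ^ 2 ≤ (T : ℝ) ^ 2 / ((max b g : ℕ) : ℝ) ^ 2 := by
          rw [← div_pow]
          gcongr
          exact Nat.cast_div_le
        refine hd.trans ?_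
        rcases le_total g b with h | h
        · rw [max_eq_left h, if_pos h]
          apply le_add_of_nonneg_right
          split_ifs <;> positivity
        · rw [max_eq_right h, if_pos h]
          apply le_add_of_nonneg_left
          split_ifs <;> positivity
    _ = 2 * T ^ 2 * ∑ b ∈ Finset.Ioc 0 T, (b : ℝ)⁻¹ := by
        simp_rw [Finset.sum_add_distrib]
        rw [Finset.sum_comm (f := fun b g : ℕ => if b ≤ g then (T : ℝ) ^ 2 / (g : ℝ) ^ 2 else 0),
          Finset.sum_congr rfl hin, ← Finset.mul_sum]
        ring
    _ ≤ _ := by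
        gcongr
        have h := harmonic_le_one_add_log T
        rw [harmonic_eq_sum_Icc] at h
        push_cast at h
        simpa [← Finset.Icc_add_one_left_eq_Ioc] using h

lemma exists_sum_r2_sq_le : ∃ C : ℝ, 0 < C ∧ ∀ N : ℕ, 1 ≤ N →
    ∑ n ∈ Finset.Ioc 0 N, (r2 n : ℝ) ^ 2 ≤ C * N * (1 + Real.log N) := by
  refine ⟨1000, by norm_num, fun N hN => ?_⟩
  have hN1 : (1 : ℝ) ≤ N := by exact_mod_cast hN
  have h1 := sum_r2_sq_le_card N
  have h2 := card_mulEqFinset_le (2 * N.sqrt)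
  have h3 := sum_div_max_sq_le (2 * N.sqrt)
  set T := 2 * N.sqrt with hT
  have hs : (N.sqrt : ℝ) ^ 2 ≤ N := by exact_mod_cast Nat.sqrt_le' N
  have hs1 : (1 : ℝ) ≤ N.sqrt := by
    exact_mod_cast Nat.le_sqrt.2 (by omega)
  have hTr : (T : ℝ) = 2 * N.sqrt := by rw [hT]; push_cast; ring
  have hlogN : 0 ≤ Real.log N := Real.log_nonneg hN1
  have hlog : Real.log T ≤ 1 + Real.log N := by
    rw [hTr, Real.log_mul (by norm_num) (by positivity)]
    have := Real.log_le_sub_one_of_pos (show (0 : ℝ) < 2 by norm_num)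
    have : Real.log N.sqrt ≤ Real.log N :=
      Real.log_le_log (by positivity) (by exact_mod_cast Nat.sqrt_le_self N)
    linarith
  have h1' : ∑ n ∈ Finset.Ioc 0 N, (r2 n : ℝ) ^ 2 ≤ 16 * (mulEqFinset T).card := by
    exact_mod_cast h1
  have h2' : ((mulEqFinset T).card : ℝ) ≤ 4 * (T + 1) ^ 2 + 2 * T ^ 2 * (1 + Real.log T) := by
    refine le_trans ?_ (add_le_add_right h3 _)
    exact_mod_cast h2
  have h4 : (4 * (T + 1) ^ 2 : ℝ) ≤ 36 * N := by
    rw [hTr]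
    nlinarith
  have h5 : 2 * (T : ℝ) ^ 2 * (1 + Real.log T) ≤ 8 * N * (2 + Real.log N) := by
    have : (T : ℝ) ^ 2 ≤ 4 * N := by rw [hTr]; linarith
    calc _ ≤ 2 * (4 * (N : ℝ)) * (1 + (1 + Real.log N)) := by gcongr
      _ = _ := by ring
  nlinarith [mul_nonneg (show (0 : ℝ) ≤ N by linarith) hlogN]

open scoped Classical in
lemma betweenCount_eq_card (m n : ℕ) :
    betweenCount m n = ((Finset.Ioo (min m n) (max m n)).filter (· ∈ SOS)).card := by
  rw [betweenCount, Nat.subtype_card]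
  intro k
  rw [Finset.mem_filter, Finset.mem_Ioo]
  tauto

lemma mul_sqrt_sqrt_le_betweenCount {m n : ℕ} (hn : 9 ≤ n) (hmn : 16 * m < n) :
    (n.sqrt - n.sqrt / 2) * n.sqrt.sqrt ≤ betweenCount m n := by
  classical
  have hK3 : 3 ≤ n.sqrt := Nat.le_sqrt.2 (by omega)
  have hKn : n.sqrt * n.sqrt ≤ n := Nat.sqrt_le n
  have hnK : n < (n.sqrt + 1) * (n.sqrt + 1) := Nat.lt_succ_sqrt n
  have hsK : n.sqrt.sqrt * n.sqrt.sqrt ≤ n.sqrt := Nat.sqrt_le _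
  set K := n.sqrt
  set s := K.sqrt
  rw [betweenCount_eq_card, min_eq_left (by omega), max_eq_right (by omega),
    ← Nat.card_Ico, ← Finset.card_range s, ← Finset.card_product]
  have hb : ∀ a b, a ∈ Finset.Ico (K / 2) K → b ∈ Finset.range s → b ^ 2 ≤ 2 * a := by
    intro a b ha hb
    rw [Finset.mem_Ico] at ha
    rw [Finset.mem_range] at hb
    have : (b + 1) * (b + 1) ≤ K := (Nat.mul_le_mul hb hb).trans hsK
    have : b ^ 2 + 1 ≤ K := by nlinarith
    omega
  refine Finset.card_le_card_of_injOn (fun p => p.1 ^ 2 + p.2 ^ 2) ?_ ?_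
  · rintro ⟨a, b⟩ h
    rw [Finset.mem_coe, Finset.mem_product] at h
    have hb' := hb _ _ h.1 h.2
    rw [Finset.mem_Ico] at h
    simp only [Finset.mem_coe, Finset.mem_filter, Finset.mem_Ioo] at hb' ⊢
    obtain ⟨⟨h1, h2⟩, -⟩ := h
    simp only at h1 h2
    refine ⟨⟨?_, ?_⟩, ⟨a, b, by push_cast; ring⟩⟩
    · have e1 : K ≤ 2 * a + 1 := by omega
      have e2 : (K + 1) * (K + 1) ≤ 16 * a ^ 2 := by nlinarith
      nlinarith
    · nlinarith
  · rintro ⟨a, b⟩ h ⟨c, d⟩ h' e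
    rw [Finset.mem_coe, Finset.mem_product] at h h'
    have h1 := hb _ _ h.1 h.2
    have h2 := hb _ _ h'.1 h'.2
    simp only at h1 h2 e
    have hac : a = c := by
      rcases lt_trichotomy a c with h | h | h
      · nlinarith
      · exact h
      · nlinarith
    subst hac
    have : b = d := by
      have : b ^ 2 = d ^ 2 := by omega
      exact Nat.pow_left_injective two_ne_zero this
    rw [this]

/-- The number of sums of two squares required between `n` and an element of the dense set. -/
def separation (ε : ℝ) (n : ℕ) : ℝ := (r2 n : ℝ) ^ (5 / 4 - ε) / Real.log (r2 n)

lemma separation_of_r2_le_one {ε : ℝ} {n : ℕ} (h : r2 n ≤ 1) : separation ε n = 0 := by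
  unfold separation
  interval_cases r2 n <;> simp

lemma separation_le {ε : ℝ} (n : ℕ) : separation ε n ≤ 2 * (r2 n : ℝ) ^ (5 / 4 - ε) := by
  rcases Nat.lt_or_ge 1 (r2 n) with h | h
  · have h2 : (2 : ℝ) ≤ r2 n := by exact_mod_cast h
    have h3 : 1 / 2 ≤ Real.log (r2 n) := by
      have := Real.log_le_log (by norm_num) h2
      linarith [Real.log_two_gt_d9]
    rw [separation, div_le_iff₀ (by linarith)]
    have : 0 ≤ (r2 n : ℝ) ^ (5 / 4 - ε) := by positivity
    nlinarith
  · rw [separation_of_r2_le_one h]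
    positivity

lemma exists_separation_le_betweenCount {ε : ℝ} (hε : 0 < ε) : ∃ n₀ : ℕ, ∀ n : ℕ, n₀ ≤ n →
    ∀ m : ℕ, 16 * m < n → separation ε n ≤ betweenCount m n := by
  have hlim : Tendsto (fun n : ℕ => ((n.sqrt : ℕ) : ℝ) ^ (1 / 4 : ℝ)) atTop atTop := by
    refine (tendsto_rpow_atTop (by norm_num)).comp (tendsto_natCast_atTop_atTop.comp ?_)
    refine tendsto_atTop.2 fun b => ?_
    filter_upwards [eventually_ge_atTop (b * b)] with n hn using Nat.le_sqrt.2 hn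
  obtain ⟨n₀, hn₀⟩ := eventually_atTop.1 (hlim.eventually_ge_atTop (8 * (6 : ℝ) ^ (5 / 4 : ℝ)))
  refine ⟨max 9 n₀, fun n hn m hmn => ?_⟩
  have h9 : 9 ≤ n := (le_max_left _ _).trans hn
  have hbig := hn₀ n ((le_max_right _ _).trans hn)
  have hK1 : 1 ≤ n.sqrt := Nat.le_sqrt.2 (by omega)
  have h1 := mul_sqrt_sqrt_le_betweenCount h9 hmn
  set K := n.sqrt
  have hKr : (1 : ℝ) ≤ K := by exact_mod_cast hK1
  have hr : (r2 n : ℝ) ≤ 6 * K := by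
    have := r2_le n
    have : r2 n ≤ 6 * K := by omega
    exact_mod_cast this
  have hs : (K : ℝ) ^ (1 / 2 : ℝ) ≤ 2 * K.sqrt := by
    rw [← Real.sqrt_eq_rpow, Real.sqrt_le_left (by positivity)]
    have e1 := Nat.sqrt_lt'.1 (Nat.lt_succ_self K.sqrt)
    have e2 : 1 ≤ K.sqrt := Nat.le_sqrt.2 (by omega)
    have e3 : K ≤ (2 * K.sqrt) ^ 2 := e1.le.trans (Nat.pow_le_pow_left (by omega) 2)
    exact_mod_cast e3
  have h2 : (K : ℝ) / 2 * K.sqrt ≤ betweenCount m n := by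
    have h3 : K * K.sqrt ≤ 2 * betweenCount m n := by
      calc _ ≤ (2 * (K - K / 2)) * K.sqrt := Nat.mul_le_mul_right _ (by omega)
        _ ≤ _ := by rw [mul_assoc]; exact Nat.mul_le_mul_left _ h1
    have : (K : ℝ) * K.sqrt ≤ 2 * betweenCount m n := by exact_mod_cast h3
    linarith
  rcases Nat.lt_or_ge 0 (r2 n) with h0 | h0
  · have h0' : (1 : ℝ) ≤ r2 n := by exact_mod_cast h0
    calc separation ε n ≤ 2 * (r2 n : ℝ) ^ (5 / 4 - ε) := separation_le n
      _ ≤ 2 * (r2 n : ℝ) ^ (5 / 4 : ℝ) := by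
        gcongr
        linarith
      _ ≤ 2 * (6 * K : ℝ) ^ (5 / 4 : ℝ) := by gcongr
      _ = (8 * 6 ^ (5 / 4 : ℝ)) * (K : ℝ) ^ (5 / 4 : ℝ) / 4 := by
        rw [Real.mul_rpow (by norm_num) (by positivity)]
        ring
      _ ≤ (K : ℝ) ^ (1 / 4 : ℝ) * (K : ℝ) ^ (5 / 4 : ℝ) / 4 := by gcongr
      _ = K / 4 * (K : ℝ) ^ (1 / 2 : ℝ) := by
        rw [← Real.rpow_add (by linarith), show (1 / 4 + 5 / 4 : ℝ) = 1 + 1 / 2 by norm_num,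
          Real.rpow_add (by linarith), Real.rpow_one]
        ring
      _ ≤ K / 4 * (2 * K.sqrt) := by gcongr
      _ = K / 2 * K.sqrt := by ring
      _ ≤ _ := h2
  · rw [separation_of_r2_le_one (by omega)]
    positivity

lemma card_le_of_betweenCount_le {F : Finset ℕ} {n t : ℕ} (hF : ∀ m ∈ F, m ∈ SOS)
    (ht : ∀ m ∈ F, betweenCount m n ≤ t) : F.card ≤ 2 * t + 3 := by
  classical
  have hlt : (F.filter (· < n)).card ≤ t + 1 := by
    rcases (F.filter (· < n)).eq_empty_or_nonempty with h | h
    · simp [h]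
    · set a := (F.filter (· < n)).min' h with ha
      have hmem := Finset.mem_filter.1 ((F.filter (· < n)).min'_mem h)
      rw [← ha] at hmem
      have h1 := ht a hmem.1
      rw [betweenCount_eq_card, min_eq_left hmem.2.le, max_eq_right hmem.2.le] at h1
      have hsub : F.filter (· < n) ⊆ insert a ((Finset.Ioo a n).filter (· ∈ SOS)) := by
        intro m hm
        have := (F.filter (· < n)).min'_le m hm
        rw [← ha] at this
        rw [Finset.mem_filter] at hm
        rw [Finset.mem_insert, Finset.mem_filter, Finset.mem_Ioo]
        have := hF m hm.1
        have := hm.2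
        rcases eq_or_ne m a with h | h
        · exact Or.inl h
        · exact Or.inr ⟨⟨by omega, by omega⟩, hF m hm.1⟩
      have := (Finset.card_le_card hsub).trans (Finset.card_insert_le _ _)
      omega
  have hgt : (F.filter (n < ·)).card ≤ t + 1 := by
    rcases (F.filter (n < ·)).eq_empty_or_nonempty with h | h
    · simp [h]
    · set a := (F.filter (n < ·)).max' h with ha
      have hmem := Finset.mem_filter.1 ((F.filter (n < ·)).max'_mem h)
      rw [← ha] at hmem
      have h1 := ht a hmem.1
      rw [betweenCount_eq_card, min_eq_right hmem.2.le, max_eq_left hmem.2.le] at h1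
      have hsub : F.filter (n < ·) ⊆ insert a ((Finset.Ioo n a).filter (· ∈ SOS)) := by
        intro m hm
        have := (F.filter (n < ·)).le_max' m hm
        rw [← ha] at this
        rw [Finset.mem_filter] at hm
        rw [Finset.mem_insert, Finset.mem_filter, Finset.mem_Ioo]
        have := hm.2
        rcases eq_or_ne m a with h | h
        · exact Or.inl h
        · exact Or.inr ⟨⟨by omega, by omega⟩, hF m hm.1⟩
      have := (Finset.card_le_card hsub).trans (Finset.card_insert_le _ _)
      omega
  have hsub : F ⊆ insert n (F.filter (· < n) ∪ F.filter (n < ·)) := by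
    intro m hm
    simp only [Finset.mem_insert, Finset.mem_union, Finset.mem_filter, hm, true_and]
    omega
  have h1 := (Finset.card_le_card hsub).trans (Finset.card_insert_le _ _)
  have h2 := Finset.card_union_le (F.filter (· < n)) (F.filter (n < ·))
  omega

/-- The sums of two squares that are not separated from some `n` with large `r2 n`. -/
def exceptionalSet (ε : ℝ) : Set ℕ :=
  {m | m ∈ SOS ∧ ∃ n ∈ SOS, Real.log n ^ 2 ≤ (r2 n : ℝ) ∧ (betweenCount m n : ℝ) < separation ε n}

open scoped Classical in
/-- The `n ≤ X` for which `r2 n` is large. -/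
def largeFinset (X : ℕ) : Finset ℕ :=
  (Finset.Ioc 0 X).filter fun n => n ∈ SOS ∧ Real.log n ^ 2 ≤ (r2 n : ℝ)

lemma mem_largeFinset {X n : ℕ} : n ∈ largeFinset X ↔
    (0 < n ∧ n ≤ X) ∧ n ∈ SOS ∧ Real.log n ^ 2 ≤ (r2 n : ℝ) := by
  classical
  rw [largeFinset, Finset.mem_filter, Finset.mem_Ioc]

open scoped Classical in
lemma exists_card_exceptionalSet_le {ε : ℝ} (hε : 0 < ε) (hε1 : ε ≤ 1) :
    ∃ x₀ : ℕ, ∀ x : ℕ, x₀ ≤ x →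
      (((Finset.range (x + 1)).filter (· ∈ exceptionalSet ε)).card : ℝ) ≤
        7 * ∑ n ∈ largeFinset (16 * x), (r2 n : ℝ) ^ (5 / 4 - ε) := by
  obtain ⟨n₀, hn₀⟩ := exists_separation_le_betweenCount hε
  refine ⟨n₀, fun x hx => ?_⟩
  let bad : ℕ → Finset ℕ := fun n => (Finset.range (x + 1)).filter
    fun m => m ∈ SOS ∧ (betweenCount m n : ℝ) < separation ε n
  have hsub : (Finset.range (x + 1)).filter (· ∈ exceptionalSet ε) ⊆
      (largeFinset (16 * x)).biUnion bad := by
    intro m hm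
    rw [Finset.mem_filter, Finset.mem_range] at hm
    obtain ⟨hmx, hm, n, hn, hlog, hlt⟩ := hm
    have hn0 : n ≠ 0 := by
      rintro rfl
      have h1 : r2 0 ≤ 1 := by
        rw [r2_eq_card]
        exact (Finset.card_filter_le _ _).trans (by simp)
      rw [separation_of_r2_le_one h1] at hlt
      exact absurd hlt (by simp)
    have hnx : n ≤ 16 * x := by
      by_contra! hc
      exact absurd (hn₀ n (by omega) m (by omega)) (not_le.2 hlt)
    simp only [largeFinset, bad, Finset.mem_biUnion, Finset.mem_filter, Finset.mem_Ioc,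
      Finset.mem_range]
    exact ⟨n, ⟨⟨by omega, hnx⟩, hn, hlog⟩, hmx, hm, hlt⟩
  have hbad : ∀ n ∈ largeFinset (16 * x), ((bad n).card : ℝ) ≤ 7 * (r2 n : ℝ) ^ (5 / 4 - ε) := by
    intro n hn
    have hr : (1 : ℝ) ≤ r2 n := by exact_mod_cast one_le_r2 (mem_largeFinset.1 hn).2.1
    have h1 : 1 ≤ (r2 n : ℝ) ^ (5 / 4 - ε) := Real.one_le_rpow hr (by linarith)
    have hsep0 : 0 ≤ separation ε n :=
      div_nonneg (by positivity) (Real.log_nonneg hr)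
    have hc : (bad n).card ≤ 2 * ⌊separation ε n⌋₊ + 3 := by
      refine card_le_of_betweenCount_le (n := n) (fun m hm => (Finset.mem_filter.1 hm).2.1) ?_
      exact fun m hm => Nat.le_floor (Finset.mem_filter.1 hm).2.2.le
    have hc' : ((bad n).card : ℝ) ≤ 2 * ⌊separation ε n⌋₊ + 3 := by exact_mod_cast hc
    have := Nat.floor_le hsep0
    have := separation_le (ε := ε) n
    linarith
  have h1 : ((Finset.range (x + 1)).filter (· ∈ exceptionalSet ε)).card ≤
      ∑ n ∈ largeFinset (16 * x), (bad n).card :=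
    (Finset.card_le_card hsub).trans Finset.card_biUnion_le
  calc _ ≤ ((∑ n ∈ largeFinset (16 * x), (bad n).card : ℕ) : ℝ) := by exact_mod_cast h1
    _ ≤ _ := by
      push_cast
      rw [Finset.mul_sum]
      exact Finset.sum_le_sum hbad

lemma exists_sum_largeFinset_le {ε : ℝ} (hε : 0 < ε) : ∃ C : ℝ, 0 < C ∧ ∀ X : ℕ, 2 ≤ X →
    ∑ n ∈ largeFinset X, (r2 n : ℝ) ^ (5 / 4 - ε) ≤
      C * (1 + Real.log X) * (√X + X * (Real.log X / 2) ^ (-(3 / 2 + 2 * ε))) := by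
  obtain ⟨C, hC, h2⟩ := exists_sum_r2_sq_le
  refine ⟨C, hC, fun X hX => ?_⟩
  have hXr : (2 : ℝ) ≤ X := by exact_mod_cast hX
  have hlogX : 0 < Real.log X := Real.log_pos (by linarith)
  set w := (Real.log X / 2) ^ (-(3 / 2 + 2 * ε)) with hw
  have hw0 : 0 ≤ w := by positivity
  have hpt : ∀ n ∈ largeFinset X, (r2 n : ℝ) ^ (5 / 4 - ε) ≤
      (if n ≤ X.sqrt then (r2 n : ℝ) ^ 2 else 0) + w * (r2 n : ℝ) ^ 2 := by
    intro n hn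
    obtain ⟨hn, hnS, hlog⟩ := mem_largeFinset.1 hn
    have hr : (1 : ℝ) ≤ r2 n := by exact_mod_cast one_le_r2 hnS
    split_ifs with hs
    · have : (r2 n : ℝ) ^ (5 / 4 - ε) ≤ (r2 n : ℝ) ^ (2 : ℝ) :=
        Real.rpow_le_rpow_of_exponent_le hr (by linarith)
      rw [Real.rpow_two] at this
      have : 0 ≤ w * (r2 n : ℝ) ^ 2 := by positivity
      linarith
    · rw [zero_add]
      have hX2 : X < n * n := Nat.sqrt_lt.1 (not_le.1 hs)
      have hn0 : (0 : ℝ) < n := by exact_mod_cast hn.1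
      have hl : Real.log X / 2 ≤ Real.log n := by
        have : Real.log X ≤ Real.log ((n : ℝ) * n) :=
          Real.log_le_log (by linarith) (by exact_mod_cast hX2.le)
        rw [Real.log_mul hn0.ne' hn0.ne'] at this
        linarith
      have hl2 : (Real.log X / 2) ^ 2 ≤ r2 n := le_trans (by gcongr) hlog
      have hp : (r2 n : ℝ) ^ (-(3 / 4 + ε)) ≤ w := by
        calc (r2 n : ℝ) ^ (-(3 / 4 + ε)) ≤ ((Real.log X / 2) ^ 2) ^ (-(3 / 4 + ε)) :=
              Real.rpow_le_rpow_of_nonpos (by positivity) hl2 (by linarith)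
          _ = w := by
            rw [hw, ← Real.rpow_two, ← Real.rpow_mul (by positivity)]
            ring_nf
      calc (r2 n : ℝ) ^ (5 / 4 - ε) = (r2 n : ℝ) ^ (-(3 / 4 + ε)) * (r2 n : ℝ) ^ (2 : ℝ) := by
            rw [← Real.rpow_add (by linarith)]
            ring_nf
        _ ≤ _ := by rw [Real.rpow_two]; gcongr
  have hX0 : 1 ≤ X.sqrt := Nat.le_sqrt.2 (by omega)
  have hsum1 : ∑ n ∈ Finset.Ioc 0 X, (if n ≤ X.sqrt then (r2 n : ℝ) ^ 2 else 0) ≤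
      C * √X * (1 + Real.log X) := by
    rw [← Finset.sum_filter]
    have : (Finset.Ioc 0 X).filter (· ≤ X.sqrt) = Finset.Ioc 0 X.sqrt := by
      ext n
      have := Nat.sqrt_le_self X
      simp only [Finset.mem_filter, Finset.mem_Ioc]
      omega
    rw [this]
    refine (h2 _ hX0).trans ?_
    have hx0 : (0 : ℝ) < X.sqrt := by exact_mod_cast hX0
    have e1 : (X.sqrt : ℝ) ≤ √X := Real.nat_sqrt_le_real_sqrt
    have e2 : Real.log X.sqrt ≤ Real.log X :=
      Real.log_le_log hx0 (by exact_mod_cast Nat.sqrt_le_self X)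
    have e3 : 0 ≤ Real.log X.sqrt := Real.log_nonneg (by exact_mod_cast hX0)
    gcongr
  calc _ ≤ ∑ n ∈ largeFinset X,
          ((if n ≤ X.sqrt then (r2 n : ℝ) ^ 2 else 0) + w * (r2 n : ℝ) ^ 2) :=
        Finset.sum_le_sum hpt
    _ ≤ ∑ n ∈ Finset.Ioc 0 X,
          ((if n ≤ X.sqrt then (r2 n : ℝ) ^ 2 else 0) + w * (r2 n : ℝ) ^ 2) := by
        refine Finset.sum_le_sum_of_subset_of_nonneg ?_ fun n _ _ => ?_
        · exact fun n hn => Finset.mem_Ioc.2 (mem_largeFinset.1 hn).1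
        · split_ifs <;> positivity
    _ ≤ C * √X * (1 + Real.log X) + w * (C * X * (1 + Real.log X)) := by
        rw [Finset.sum_add_distrib, ← Finset.mul_sum]
        exact add_le_add hsum1 (mul_le_mul_of_nonneg_left (h2 X (by omega)) hw0)
    _ = _ := by ring

lemma tendsto_log_sq_div_sqrt :
    Tendsto (fun y : ℝ => Real.log y ^ 2 / √y) atTop (𝓝 0) := by
  have := (isLittleO_log_rpow_rpow_atTop (2 : ℝ)
    (show (0 : ℝ) < 1 / 2 by norm_num)).tendsto_div_nhds_zero
  simpa only [Real.rpow_two, ← Real.sqrt_eq_rpow] using this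

lemma tendsto_sqrt_log_div_mul {ε : ℝ} (hε : 0 < ε) :
    Tendsto (fun y : ℝ => √(Real.log y) / y *
      ((1 + Real.log y) * (√y + y * (Real.log y / 2) ^ (-(3 / 2 + 2 * ε))))) atTop (𝓝 0) := by
  have hpow : Tendsto (fun y : ℝ => (Real.log y / 2) ^ (-(2 * ε))) atTop (𝓝 0) :=
    (tendsto_rpow_neg_atTop (by linarith)).comp
      (Real.tendsto_log_atTop.atTop_div_const (by norm_num))
  have hlim : Tendsto (fun y : ℝ => 2 * (Real.log y ^ 2 / √y) +
      6 * (Real.log y / 2) ^ (-(2 * ε))) atTop (𝓝 0) := by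
    simpa using (tendsto_log_sq_div_sqrt.const_mul 2).add (hpow.const_mul 6)
  refine squeeze_zero' ?_ ?_ hlim
  · filter_upwards [eventually_ge_atTop 1] with y hy
    have := Real.log_nonneg hy
    positivity
  · filter_upwards [eventually_ge_atTop 1,
      Real.tendsto_log_atTop.eventually_ge_atTop 2] with y hy hl
    have hy0 : 0 < y := by linarith
    set l := Real.log y / 2 with hldef
    have hl1 : 1 ≤ l := by rw [hldef]; linarith
    have hlog : Real.log y = 2 * l := by rw [hldef]; ring
    rw [hlog]
    have hs1 : √(2 * l) ≤ 2 * l := Real.sqrt_le_self_iff.2 (Or.inr (by linarith))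
    have hs2 : √(2 * l) ≤ 2 * l ^ (1 / 2 : ℝ) := by
      rw [Real.sqrt_mul (by norm_num), ← Real.sqrt_eq_rpow]
      have : √2 ≤ 2 := Real.sqrt_le_self_iff.2 (Or.inr (by norm_num))
      gcongr
    have hy2 : √y / y = 1 / √y := Real.sqrt_div_self'
    have hsplit : √(2 * l) / y * ((1 + 2 * l) * (√y + y * l ^ (-(3 / 2 + 2 * ε)))) =
        √(2 * l) * (1 + 2 * l) * (√y / y) +
          √(2 * l) * (1 + 2 * l) * l ^ (-(3 / 2 + 2 * ε)) := by
      field_simp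
    rw [hsplit, hy2]
    have h1 : √(2 * l) * (1 + 2 * l) * (1 / √y) ≤ 2 * ((2 * l) ^ 2 / √y) := by
      calc _ ≤ 2 * l * (2 * l + 2 * l) * (1 / √y) := by gcongr; linarith
        _ = _ := by ring
    have h2 : √(2 * l) * (1 + 2 * l) * l ^ (-(3 / 2 + 2 * ε)) ≤ 6 * l ^ (-(2 * ε)) := by
      calc _ ≤ 2 * l ^ (1 / 2 : ℝ) * (l + 2 * l) * l ^ (-(3 / 2 + 2 * ε)) := by gcongr
        _ = 6 * (l ^ (1 / 2 : ℝ) * l ^ (1 : ℝ) * l ^ (-(3 / 2 + 2 * ε))) := by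
          rw [Real.rpow_one]; ring
        _ = _ := by
          rw [← Real.rpow_add (by linarith), ← Real.rpow_add (by linarith)]
          ring_nf
    exact add_le_add h1 h2

open scoped Classical in
lemma natCard_mem_le_eq (S : Set ℕ) (x : ℕ) :
    Nat.card {m : ℕ // m ∈ S ∧ m ≤ x} = ((Finset.range (x + 1)).filter (· ∈ S)).card := by
  rw [Nat.subtype_card]
  intro k
  rw [Finset.mem_filter, Finset.mem_range, Nat.lt_succ_iff, and_comm]

open scoped Classical in
lemma sum_sosIndicator_le_card (x : ℕ) :
    ∑ n ∈ Finset.Ioc 0 x, sosIndicator n ≤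
      (((Finset.range (x + 1)).filter (· ∈ SOS)).card : ℝ) := by
  calc _ ≤ ∑ n ∈ Finset.range (x + 1), sosIndicator n := by
        refine Finset.sum_le_sum_of_subset_of_nonneg (fun n hn => ?_)
          fun n _ _ => sosIndicator_nonneg n
        rw [Finset.mem_Ioc] at hn
        exact Finset.mem_range.2 (by omega)
    _ ≤ ∑ n ∈ Finset.range (x + 1), if n ∈ SOS then (1 : ℝ) else 0 := by
        refine Finset.sum_le_sum fun n _ => ?_
        split_ifs with h
        · exact sosIndicator_le_one n
        · exact (sosIndicator_of_notMem h).le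
    _ = _ := by rw [← Finset.sum_filter]; simp

open scoped Classical in
lemma tendsto_card_exceptionalSet_div {ε : ℝ} (hε : 0 < ε) (hε1 : ε ≤ 1) :
    Tendsto (fun x : ℕ => (((Finset.range (x + 1)).filter (· ∈ exceptionalSet ε)).card : ℝ) /
      (((Finset.range (x + 1)).filter (· ∈ SOS)).card : ℝ)) atTop (𝓝 0) := by
  obtain ⟨c, hc, N₀, hN₀, hsos⟩ := exists_le_sum_sosIndicator
  obtain ⟨x₀, hexc⟩ := exists_card_exceptionalSet_le hε hε1
  obtain ⟨C, hC, hlarge⟩ := exists_sum_largeFinset_le hε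
  have hy : Tendsto (fun x : ℕ => ((16 * x : ℕ) : ℝ)) atTop atTop :=
    tendsto_natCast_atTop_atTop.comp (tendsto_id.const_mul_atTop' (by norm_num))
  have hlim := ((tendsto_sqrt_log_div_mul hε).comp hy).const_mul (7 * C * 16 / c)
  rw [mul_zero] at hlim
  refine squeeze_zero' (Eventually.of_forall fun x => by positivity) ?_ hlim
  filter_upwards [eventually_ge_atTop x₀, eventually_ge_atTop N₀] with x hx hxN
  have h1 := (hexc x hx).trans
    (mul_le_mul_of_nonneg_left (hlarge (16 * x) (by omega)) (by norm_num))
  have h2 : c * x ≤ (((Finset.range (x + 1)).filter (· ∈ SOS)).card : ℝ) *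
      √(Real.log (16 * x : ℕ)) := by
    refine (hsos x hxN).trans (mul_le_mul (sum_sosIndicator_le_card x) ?_ (by positivity)
      (by positivity))
    have hx0 : (0 : ℝ) < x := by exact_mod_cast (by omega : 0 < x)
    refine Real.sqrt_le_sqrt (Real.log_le_log hx0 ?_)
    exact_mod_cast (by omega : x ≤ 16 * x)
  have hx0 : (0 : ℝ) < x := by exact_mod_cast (by omega : 0 < x)
  have hcx : 0 < c * x := by positivity
  have hpos : (0 : ℝ) < (((Finset.range (x + 1)).filter (· ∈ SOS)).card : ℝ) := by
    by_contra! h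
    have := mul_nonpos_of_nonpos_of_nonneg h (Real.sqrt_nonneg (Real.log (16 * x : ℕ)))
    linarith
  set N := (((Finset.range (x + 1)).filter (· ∈ SOS)).card : ℝ)
  set L := √(Real.log (16 * x : ℕ))
  rw [div_le_iff₀ hpos]
  refine h1.trans ?_
  simp only [Function.comp_apply]
  set A := (1 + Real.log (16 * x : ℕ)) *
    (√(16 * x : ℕ) + (16 * x : ℕ) * (Real.log (16 * x : ℕ) / 2) ^ (-(3 / 2 + 2 * ε))) with hA
  have hA0 : 0 ≤ A := by
    have : 0 ≤ Real.log (16 * x : ℕ) := Real.log_natCast_nonneg _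
    positivity
  have h3 : 1 ≤ N * L / (c * x) := (one_le_div hcx).2 h2
  have e : 7 * C * 16 / c * (L / (16 * x : ℕ) * A) * N = 7 * (C * A) * (N * L / (c * x)) := by
    push_cast
    field_simp
  rw [e, mul_assoc C, ← hA]
  exact le_mul_of_one_le_right (by positivity) h3

lemma fullDensityIn_diff_exceptionalSet {ε : ℝ} (hε : 0 < ε) (hε1 : ε ≤ 1) :
    FullDensityIn (SOS \ exceptionalSet ε) := by
  classical
  refine ⟨Set.sdiff_subset, ?_⟩
  have hlim := (tendsto_card_exceptionalSet_div hε hε1).const_sub 1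
  rw [sub_zero] at hlim
  refine hlim.congr fun x => ?_
  have h0 : 0 ∈ SOS := ⟨0, 0, by norm_num⟩
  have hpos : (((Finset.range (x + 1)).filter (· ∈ SOS)).card : ℝ) ≠ 0 := by
    rw [Nat.cast_ne_zero, Finset.card_ne_zero]
    exact ⟨0, Finset.mem_filter.2 ⟨Finset.mem_range.2 x.succ_pos, h0⟩⟩
  have hcard : ((Finset.range (x + 1)).filter (· ∈ SOS)).card =
      ((Finset.range (x + 1)).filter (· ∈ SOS \ exceptionalSet ε)).card +
        ((Finset.range (x + 1)).filter (· ∈ exceptionalSet ε)).card := by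
    rw [← Finset.card_union_of_disjoint]
    · congr 1
      ext k
      simp only [Finset.mem_union, Finset.mem_filter, Set.mem_sdiff]
      have : k ∈ exceptionalSet ε → k ∈ SOS := fun h => h.1
      tauto
    · rw [Finset.disjoint_filter]
      exact fun k _ h => h.2
  rw [natCard_mem_le_eq, natCard_mem_le_eq, one_sub_div hpos, hcard]
  push_cast
  rw [add_sub_cancel_right]
  congr!

/-- For large `r₂(n)`, at least `c_ε r₂(n)^{5/4 − ε}/log r₂(n)` elements of `𝒩`
lie between `m` and `n`, for `m` in a full density subset of `𝒩`. -/
theorem large_r2_separation :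
    ∀ ε : ℝ, 0 < ε →
      ∃ (c : ℝ) (S : Set ℕ), 0 < c ∧ FullDensityIn S ∧
        ∀ m ∈ S, ∀ n ∈ SOS, Real.log n ^ 2 ≤ (r2 n : ℝ) →
          c * (r2 n : ℝ) ^ (5 / 4 - ε) / Real.log (r2 n) ≤ (betweenCount m n : ℝ) := by
  intro ε hε
  have hδ : 0 < min ε 1 := lt_min hε one_pos
  refine ⟨1, SOS \ exceptionalSet (min ε 1), one_pos,
    fullDensityIn_diff_exceptionalSet hδ (min_le_right _ _), fun m hm n hn hlog => ?_⟩
  have hr : (1 : ℝ) ≤ r2 n := by exact_mod_cast one_le_r2 hn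
  have hsep : separation (min ε 1) n ≤ betweenCount m n := by
    by_contra! h
    exact hm.2 ⟨hm.1, n, hn, hlog, h⟩
  refine le_trans ?_ hsep
  rw [one_mul, separation]
  have := Real.log_nonneg hr
  gcongr
  exact min_le_left _ _
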